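/- arXiv:1211.0561 — 3 statements merged into one kernel-verified Lean document; each statement's English description precedes it below -/
import Mathlib

section
/- Let L be a field, let 𝒜 be a commutative L-algebra, and let V be a finite-dimensional L-vector space equipped with an 𝒜-module structure whose underlying L-scalar action (via the structure map L → 𝒜) agrees with the given L-vector space structure. Let λ : 𝒜 → L be an L-algebra homomorphism, and let V_λ = {v ∈ V : a • v = λ(a) • v for all a ∈ 𝒜} be the λ-eigenspace. Regard the L-linear dual V* = Hom_L(V, L) as an 𝒜-module via (a · f)(v) = f(a • v), and regard L as an 𝒜-module via λ. Then the map V* ⊗_𝒜 L → (V_λ)* induced by restriction of functionals to V_λ (sending f ⊗ c to c · (f restricted to V_λ)) is an isomorphism of L-vector spaces. -/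
open Module TensorProduct

section EigenDual

variable (L A V : Type*) [Field L] [CommRing A] [Algebra L A]
  [AddCommGroup V] [Module L V] [Module A V] [IsScalarTower L A V]

/-- The `L`- and `A`-actions on `V` commute, since `A` is a commutative `L`-algebra and the
`L`-action on `V` is the one obtained from the `A`-action via the structure map `L → A`. -/
instance : SMulCommClass L A V where
  smul_comm c a v := by
    rw [← IsScalarTower.algebraMap_smul A c (a • v), ← IsScalarTower.algebraMap_smul A c v,
      smul_smul, smul_smul, mul_comm]

/-- The action of `a : A` on `V` as an `L`-linear endomorphism of `V`. -/
def smulLin (a : A) : V →ₗ[L] V where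
  toFun v := a • v
  map_add' v w := smul_add a v w
  map_smul' c v := smul_comm a c v

/-- The `A`-module structure on the `L`-linear dual `V* = Hom_L(V, L)`, given by
`(a • f) v = f (a • v)`. -/
noncomputable def dualModuleA : Module A (Module.Dual L V) where
  smul a f := f.comp (smulLin L A V a)
  one_smul f := by ext v; show f ((1 : A) • v) = f v; rw [one_smul]
  mul_smul a b f := by
    ext v; show f ((a * b) • v) = f (b • a • v); rw [smul_smul, mul_comm]
  smul_zero a := by ext v; rfl
  smul_add a f g := by ext v; rfl
  add_smul a b f := by
    ext v; show f ((a + b) • v) = f (a • v) + f (b • v); rw [add_smul, map_add]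
  zero_smul f := by ext v; show f ((0 : A) • v) = 0; rw [zero_smul, map_zero]

/-- The `λ`-eigenspace `V_λ = {v ∈ V : a • v = λ(a) • v for all a ∈ 𝒜}`, an `L`-subspace
of `V`. -/
def eigenspaceOf (lam : A →ₐ[L] L) : Submodule L V where
  carrier := {v | ∀ a : A, a • v = lam a • v}
  add_mem' {v w} hv hw := fun a => by rw [smul_add, hv a, hw a, smul_add]
  zero_mem' := fun a => by rw [smul_zero, smul_zero]
  smul_mem' c v hv := fun a => by
    rw [smul_comm a c v, hv a, smul_comm c (lam a) v]

/-- The map `V* ⊗_𝒜 L → (V_λ)*` induced by restriction of functionals to the eigenspace,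
sending `f ⊗ c` to `c • (f|_{V_λ})`.  Here `L` is regarded as an `𝒜`-module via `λ`. -/
noncomputable def dualRestrictTensor (lam : A →ₐ[L] L) :
    letI := dualModuleA L A V
    letI := Module.compHom L lam.toRingHom
    (Module.Dual L V ⊗[A] L) →+ Module.Dual L (eigenspaceOf L A V lam) :=
  letI := dualModuleA L A V
  letI := Module.compHom L lam.toRingHom
  TensorProduct.liftAddHom
    { toFun := fun f => (LinearMap.toSpanSingleton L
          (Module.Dual L (eigenspaceOf L A V lam))
          (f.domRestrict (eigenspaceOf L A V lam))).toAddMonoidHom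
      map_zero' := by
        ext c v
        simp [LinearMap.smul_apply, LinearMap.domRestrict_apply]
      map_add' := fun f g => by
        ext c v
        simp [LinearMap.smul_apply, LinearMap.domRestrict_apply, mul_add] }
    (fun a f c => by
      ext v
      show c • f (a • (v : V)) = (lam a * c) • f (v : V)
      rw [v.2 a, map_smul, smul_eq_mul, smul_eq_mul, smul_eq_mul]
      ring)

theorem smul_tmul_comm {R M N : Type*} [CommSemiring R] [AddCommMonoid M] [AddCommMonoid N]
    [Module R M] [Module R N] (r : R) (m : M) (n : N) : (r • m) ⊗ₜ[R] n = m ⊗ₜ[R] (r • n) :=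
  TensorProduct.smul_tmul r m n

theorem smul_tmul_eq_zero {R M N : Type*} [CommSemiring R] [AddCommMonoid M] [AddCommMonoid N]
    [Module R M] [Module R N] (r : R) {m : M} {n : N} (h : m ⊗ₜ[R] n = 0) :
    (r • m) ⊗ₜ[R] n = 0 := by
  rw [← TensorProduct.smul_tmul', h, smul_zero]

theorem smul_eq_comp_smulLin (c : L) (f : Module.Dual L V) :
    c • f = f.comp (smulLin L A V (algebraMap L A c)) := by
  ext v
  change c • f v = f (algebraMap L A c • v)
  rw [IsScalarTower.algebraMap_smul, map_smul]

theorem comp_smulLin_tmul (lam : A →ₐ[L] L) (a : A) (f : Module.Dual L V) (c : L) :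
    letI := dualModuleA L A V
    letI := Module.compHom L lam.toRingHom
    f.comp (smulLin L A V a) ⊗ₜ[A] c = f ⊗ₜ[A] (lam a * c) :=
  letI := dualModuleA L A V
  letI := Module.compHom L lam.toRingHom
  smul_tmul_comm a f c

theorem smul_tmul_eq_tmul_mul (lam : A →ₐ[L] L) (d : L) (f : Module.Dual L V) (c : L) :
    letI := dualModuleA L A V
    letI := Module.compHom L lam.toRingHom
    (d • f) ⊗ₜ[A] c = f ⊗ₜ[A] (d * c) := by
  have h := comp_smulLin_tmul L A V lam (algebraMap L A d) f c
  rw [← smul_eq_comp_smulLin, lam.commutes] at h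
  exact h

/-- The functionals `f` on `V` such that `f ⊗ 1` vanishes in `V* ⊗_𝒜 L`. -/
noncomputable def tmulOneKer (lam : A →ₐ[L] L) : Submodule L (Module.Dual L V) :=
  letI := dualModuleA L A V
  letI := Module.compHom L lam.toRingHom
  { carrier := {f | f ⊗ₜ[A] (1 : L) = 0}
    add_mem' := fun {f g} (hf : f ⊗ₜ[A] (1 : L) = 0) (hg : g ⊗ₜ[A] (1 : L) = 0) => by
      change (f + g) ⊗ₜ[A] (1 : L) = 0
      rw [TensorProduct.add_tmul, hf, hg, add_zero]
    zero_mem' := TensorProduct.zero_tmul _ _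
    smul_mem' := fun c f (hf : f ⊗ₜ[A] (1 : L) = 0) => by
      change (c • f) ⊗ₜ[A] (1 : L) = 0
      rw [smul_eq_comp_smulLin L A V]
      exact smul_tmul_eq_zero (algebraMap L A c) hf }

theorem comp_smulLin_sub_mem_tmulOneKer (lam : A →ₐ[L] L) (a : A) (g : Module.Dual L V) :
    g.comp (smulLin L A V a) - lam a • g ∈ tmulOneKer L A V lam := by
  let := dualModuleA L A V
  let := Module.compHom L lam.toRingHom
  change (g.comp (smulLin L A V a) - lam a • g) ⊗ₜ[A] (1 : L) = 0
  have h : g.comp (smulLin L A V a) ⊗ₜ[A] (1 : L) = (lam a • g) ⊗ₜ[A] (1 : L) :=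
    (comp_smulLin_tmul L A V lam a g 1).trans (smul_tmul_eq_tmul_mul L A V lam (lam a) g 1).symm
  exact (TensorProduct.sub_tmul _ _ _).trans (sub_eq_zero.2 h)

theorem dualCoannihilator_tmulOneKer_le (lam : A →ₐ[L] L) :
    (tmulOneKer L A V lam).dualCoannihilator ≤ eigenspaceOf L A V lam := by
  intro v hv a
  rw [← sub_eq_zero, ← Module.forall_dual_apply_eq_zero_iff L]
  intro g
  have h := (Submodule.mem_dualCoannihilator v).1 hv _
    (comp_smulLin_sub_mem_tmulOneKer L A V lam a g)
  rw [map_sub, LinearMap.map_smul g]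
  exact h

theorem mem_tmulOneKer_of_domRestrict_eq_zero [FiniteDimensional L V] (lam : A →ₐ[L] L)
    (f : Module.Dual L V) (hf : f.domRestrict (eigenspaceOf L A V lam) = 0) :
    f ∈ tmulOneKer L A V lam := by
  rw [← Subspace.dualCoannihilator_dualAnnihilator_eq (W := tmulOneKer L A V lam),
    Submodule.mem_dualAnnihilator]
  intro v hv
  exact LinearMap.congr_fun hf ⟨v, dualCoannihilator_tmulOneKer_le L A V lam hv⟩

theorem exists_eq_tmul_one (lam : A →ₐ[L] L) :
    letI := dualModuleA L A V
    letI := Module.compHom L lam.toRingHom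
    ∀ x : Module.Dual L V ⊗[A] L, ∃ f : Module.Dual L V, x = f ⊗ₜ[A] (1 : L) := by
  let := dualModuleA L A V
  let := Module.compHom L lam.toRingHom
  intro x
  induction x with
  | zero => exact ⟨0, (TensorProduct.zero_tmul _ _).symm⟩
  | tmul f c =>
    refine ⟨c • f, ?_⟩
    have h := smul_tmul_eq_tmul_mul L A V lam c f 1
    rw [mul_one] at h
    exact h.symm
  | add x y hx hy =>
    obtain ⟨f, rfl⟩ := hx
    obtain ⟨g, rfl⟩ := hy
    exact ⟨f + g, (TensorProduct.add_tmul _ _ _).symm⟩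

/-- Let `L` be a field, `𝒜` a commutative `L`-algebra, and `V` a finite-dimensional
`L`-vector space with a compatible `𝒜`-module structure.  For an `L`-algebra homomorphism
`λ : 𝒜 → L`, the map `V* ⊗_𝒜 L → (V_λ)*` induced by restriction of functionals to the
`λ`-eigenspace `V_λ` (sending `f ⊗ c` to `c • (f|_{V_λ})`) is an isomorphism of
`L`-vector spaces.  (`L` is an `𝒜`-module via `λ`, and `V*` via `(a • f) v = f (a • v)`.) -/
theorem dualRestrictTensor_bijective [FiniteDimensional L V] (lam : A →ₐ[L] L) :
    letI := dualModuleA L A V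
    letI := Module.compHom L lam.toRingHom
    (∀ (f : Module.Dual L V) (c : L),
        dualRestrictTensor L A V lam (f ⊗ₜ[A] c)
          = c • f.domRestrict (eigenspaceOf L A V lam)) ∧
    Function.Bijective (dualRestrictTensor L A V lam) := by
  let := dualModuleA L A V
  let := Module.compHom L lam.toRingHom
  have key : ∀ (f : Module.Dual L V) (c : L), dualRestrictTensor L A V lam (f ⊗ₜ[A] c)
      = c • f.domRestrict (eigenspaceOf L A V lam) := fun f c => rfl
  refine ⟨key, ?_, ?_⟩
  · rw [injective_iff_map_eq_zero]
    intro x hx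
    obtain ⟨f, rfl⟩ := exists_eq_tmul_one L A V lam x
    rw [key, one_smul] at hx
    exact mem_tmulOneKer_of_domRestrict_eq_zero L A V lam f hx
  · intro g
    obtain ⟨f, hf⟩ := LinearMap.exists_extend g
    refine ⟨f ⊗ₜ[A] (1 : L), ?_⟩
    rw [key, one_smul]
    exact hf

end EigenDual
end

section
/- Let R be a reduced Noetherian commutative ring and let M be a finitely generated R-module. For an element m ∈ M, the following are equivalent: (a) there exists a non-zerodivisor a ∈ R with a • m = 0; (b) f(m) = 0 for every R-linear map f : M → R (equivalently, m lies in the kernel of the canonical map from M to its double dual M** = Hom_R(Hom_R(M,R), R)). -/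
/-- A reduced Noetherian total ring of fractions is semisimple: every ideal is complemented by
its annihilator. -/
theorem isSemisimpleRing_of_isReduced_of_isFractionRing_self
    (R : Type*) [CommRing R] [IsReduced R] [IsNoetherianRing R] [IsFractionRing R R] :
    IsSemisimpleRing R := by
  refine (isSemisimpleModule_iff R R).mpr ⟨fun I ↦ ⟨Module.annihilator R I, ?_, ?_⟩⟩
  · refine Submodule.disjoint_def.mpr fun x hx hx' ↦ ?_
    exact pow_eq_zero_iff two_ne_zero |>.mp ((sq x).trans (Submodule.mem_annihilator.mp hx' x hx))
  · refine codisjoint_iff.mpr ?_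
    by_contra hne
    have hdisj : Disjoint ((I ⊔ Module.annihilator R I : Ideal R) : Set R)
        (nonZeroDivisors R) := by
      refine Set.disjoint_left.mpr fun x hx hx' ↦ hne ?_
      exact Ideal.eq_top_of_isUnit_mem _ hx
        (IsFractionRing.self_iff_nonZeroDivisors_le_isUnit.mp ‹_› hx')
    obtain ⟨-, y, hy, hy0⟩ := SetLike.lt_iff_le_and_exists.mp
      (Ideal.bot_lt_annihilator_of_disjoint_nonZeroDivisors hdisj)
    have hy' := Submodule.mem_annihilator.mp hy
    have hyI : y ∈ Module.annihilator R I :=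
      Submodule.mem_annihilator.mpr fun x hx ↦ hy' x (Ideal.mem_sup_left hx)
    exact hy0 (pow_eq_zero_iff two_ne_zero |>.mp ((sq y).trans (hy' y (Ideal.mem_sup_right hyI))))

/-- For a finitely generated module `M` over a reduced Noetherian commutative ring `R`
and an element `m : M`, the following are equivalent:
(a) `m` is killed by some non-zerodivisor of `R`;
(b) `f m = 0` for every `R`-linear functional `f : M →ₗ[R] R`, i.e. `m` lies in the kernel
of the canonical map from `M` to its double dual. -/
theorem kill_by_nonzerodivisor_iff_dual_vanishes
    (R : Type*) [CommRing R] [IsReduced R] [IsNoetherianRing R]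
    (M : Type*) [AddCommGroup M] [Module R M] [Module.Finite R M] (m : M) :
    (∃ a ∈ nonZeroDivisors R, a • m = 0) ↔ (∀ f : M →ₗ[R] R, f m = 0) := by
  constructor
  · rintro ⟨a, ha, ham⟩ f
    refine (mul_left_mem_nonZeroDivisors_eq_zero_iff ha).mp ?_
    rw [← smul_eq_mul, ← map_smul, ham, map_zero]
  · intro h
    let S := nonZeroDivisors R
    let K := Localization S
    have : IsNoetherianRing K := IsLocalization.isNoetherianRing S K inferInstance
    have : IsFractionRing K K := IsFractionRing.idem R K
    have : IsSemisimpleRing K := isSemisimpleRing_of_isReduced_of_isFractionRing_self K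
    have : Module.Projective K (LocalizedModule S M) := Module.projective_of_isSemisimpleRing _ _
    have : Module.FinitePresentation R M := Module.finitePresentation_of_finite R M
    have hm : LocalizedModule.mkLinearMap S M m = 0 := by
      refine (Module.forall_dual_apply_eq_zero_iff K _).mp fun φ ↦ ?_
      obtain ⟨f, s, hf⟩ := Module.FinitePresentation.exists_lift_of_isLocalizedModule S
        (Algebra.linearMap R K) (φ.restrictScalars R ∘ₗ LocalizedModule.mkLinearMap S M)
      have hfm := LinearMap.congr_fun hf m
      simp only [LinearMap.comp_apply, h f, map_zero, LinearMap.smul_apply] at hfm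
      exact IsLocalizedModule.smul_injective (Algebra.linearMap R K) s
        (hfm.symm.trans (smul_zero s).symm)
    obtain ⟨s, hs⟩ := (IsLocalizedModule.eq_zero_iff S (LocalizedModule.mkLinearMap S M)).mp hm
    exact ⟨s, s.2, hs⟩
end

section
/- Let A be an integral domain and let M be an A-module. Let s₁, s₂ ∈ M be elements such that: (i) the wedge s₁ ∧ s₂ is a torsion element of the second exterior power Λ²_A M, i.e., there exists a nonzero c ∈ A with c • (s₁ ∧ s₂) = 0; and (ii) s₂ is not a torsion element of M, i.e., a • s₂ = 0 with a ∈ A implies a = 0. Then there exist a, b ∈ A with a ≠ 0 such that a • s₁ = b • s₂ in M. -/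
open ExteriorAlgebra

open scoped nonZeroDivisors in
/-- Over a domain, the wedge of a linearly independent family is not torsion. -/
theorem LinearIndependent.eq_zero_of_smul_ιMulti_eq_zero
    {A M : Type*} [CommRing A] [IsDomain A] [AddCommGroup M] [Module A M]
    {n : ℕ} {v : Fin n → M} (hv : LinearIndependent A v) {c : A}
    (hc : c • ExteriorAlgebra.ιMulti A n v = 0) : c = 0 := by
  let K := FractionRing A
  let L := LocalizedModule A⁰ M
  let f : M →ₗ[A] L := LocalizedModule.mkLinearMap A⁰ M
  have hf : LinearIndependent K (f ∘ v) := hv.of_isLocalizedModule K A⁰ f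
  obtain ⟨g, hg⟩ := (Fintype.linearCombination K (f ∘ v)).exists_leftInverse_of_injective
    (LinearMap.ker_eq_bot.2 (hf.fintypeLinearCombination_injective))
  have hgv (i : Fin n) : g (f (v i)) = Pi.single i 1 := by
    simpa using LinearMap.congr_fun hg (Pi.single i 1)
  let d : M [⋀^Fin n]→ₗ[A] K :=
    { (Matrix.detRowAlternating (R := K) (n := Fin n)).toMultilinearMap.restrictScalars A
        |>.compLinearMap fun _ => g.restrictScalars A ∘ₗ f with
      map_eq_zero_of_eq' := fun w i j hw hij =>
        Matrix.detRowAlternating.map_eq_zero_of_eq (fun i => g (f (w i)))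
          (congrArg (fun x => g (f x)) hw) hij }
  have hd : d v = 1 := by
    change Matrix.det (fun i => g (f (v i))) = 1
    rw [← Matrix.det_one (n := Fin n) (R := K)]
    congr 1
    ext i j
    rw [hgv, Matrix.one_apply, Pi.single_apply]
    simp only [eq_comm]
  have h := congrArg (liftAlternating (R := A) (Pi.single n d)) hc
  rw [map_smul, liftAlternating_apply_ιMulti, map_zero, Pi.single_eq_same, hd,
    ← Algebra.algebraMap_eq_smul_one] at h
  exact (FaithfulSMul.algebraMap_eq_zero_iff A K).1 h

/-- Let `A` be an integral domain and `M` an `A`-module.  If the wedge `s₁ ∧ s₂`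
(the image of `(s₁, s₂)` in the second exterior power `⋀[A]^2 M`, viewed inside the
exterior algebra as `ι s₁ * ι s₂`) is a torsion element, while `s₂` is not a torsion
element of `M`, then there are `a b : A` with `a ≠ 0` and `a • s₁ = b • s₂`. -/
theorem exists_relation_of_wedge_torsion
    (A : Type*) [CommRing A] [IsDomain A]
    (M : Type*) [AddCommGroup M] [Module A M] (s₁ s₂ : M)
    (h1 : ∃ c : A, c ≠ 0 ∧ c • (ι A s₁ * ι A s₂) = 0)
    (h2 : ∀ a : A, a • s₂ = 0 → a = 0) :
    ∃ a b : A, a ≠ 0 ∧ a • s₁ = b • s₂ := by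
  obtain ⟨c, hc, h⟩ := h1
  by_contra! hne
  refine hc (LinearIndependent.eq_zero_of_smul_ιMulti_eq_zero (v := ![s₁, s₂]) ?_ ?_)
  · rw [LinearIndependent.pair_iff]
    intro a b hab
    have ha : a = 0 := by
      by_contra ha
      exact hne a (-b) ha (by rw [neg_smul]; exact eq_neg_of_add_eq_zero_left hab)
    subst ha
    exact ⟨rfl, h2 b (by simpa using hab)⟩
  · simpa [ExteriorAlgebra.ιMulti_apply] using h
end
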